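/- Let α ∈ ℝ. Then Σ_{j=1}^k w_j Φ(f(A_j)) ≤ α·exp(B_U) + ( max_{x ∈ S_U} (x − α·e^x) )·1_K, and Σ_{j=1}^k w_j Φ(f(A_j)) ≥ α·exp(B_L) + ( min_{x ∈ S_L} (x − α·e^x) )·1_K, in the Loewner order, where exp is applied to B_U and B_L via continuous functional calculus and 1_K is the identity operator on K. -/

import Mathlib

open ContinuousLinearMap in
/-- The Kantorovich constant `K(m', M', r)`, with the convention that it equals `1`
for `r = 0` and `r = 1`. -/
noncomputable def kantorovich (m M r : ℝ) : ℝ :=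
  if r = 0 ∨ r = 1 then 1 else
    ((m * M ^ r - M * m ^ r) / ((r - 1) * (M - m))) *
      (((r - 1) * (M ^ r - m ^ r)) / (r * (m * M ^ r - M * m ^ r))) ^ r

open ContinuousLinearMap Polynomial

lemma one_le_kantorovich {m M : ℝ} (hm : 0 < m) (hmM : m < M) (n : ℕ) :
    1 ≤ kantorovich m M n := by
  unfold kantorovich
  split_ifs with h
  · exact le_rfl
  push Not at h
  have hn : 2 ≤ n := by
    have h0 : n ≠ 0 := mod_cast h.1
    have h1 : n ≠ 1 := mod_cast h.2
    omega
  have hn' : (2 : ℝ) ≤ n := mod_cast hn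
  have hM : 0 < M := hm.trans hmM
  simp only [Real.rpow_natCast]
  set c := m * M ^ n - M * m ^ n with hc_def
  set D := M ^ n - m ^ n with hD_def
  have hc : 0 < c := by
    obtain ⟨l, rfl⟩ : ∃ l, n = l + 1 := ⟨n - 1, by omega⟩
    have hlt : m ^ l < M ^ l := pow_lt_pow_left₀ hmM hm.le (by omega)
    have hc' : c = m * M * (M ^ l - m ^ l) := by rw [hc_def]; ring
    rw [hc']
    exact mul_pos (mul_pos hm hM) (sub_pos.2 hlt)
  have hD : 0 < D := sub_pos.2 (pow_lt_pow_left₀ hmM hm.le (by omega))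
  have hd : 0 < M - m := sub_pos.2 hmM
  have hr : (0 : ℝ) < n - 1 := by linarith
  have hn0 : (0 : ℝ) < n := by linarith
  set t := (n - 1 : ℝ) * D / (n * c) with ht_def
  have ht : 0 < t := by positivity
  have hmt : 0 < m * t := by positivity
  have bernoulli := one_add_mul_le_pow (a := m * t - 1) (by linarith) n
  have tangent : c / ((n - 1) * (M - m)) * (1 + n * (m * t - 1)) = m ^ n := by
    have hnum : m * D - c = (M - m) * m ^ n := by rw [hc_def, hD_def]; ring
    have ht' : n * t * c = (n - 1 : ℝ) * D := by rw [ht_def]; field_simp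
    rw [div_mul_eq_mul_div, div_eq_iff (by positivity)]
    linear_combination m * ht' + (n - 1 : ℝ) * hnum
  have key : m ^ n ≤ c / ((n - 1) * (M - m)) * t ^ n * m ^ n := by
    calc m ^ n = c / ((n - 1) * (M - m)) * (1 + n * (m * t - 1)) := tangent.symm
      _ ≤ c / ((n - 1) * (M - m)) * (1 + (m * t - 1)) ^ n := by gcongr
      _ = c / ((n - 1) * (M - m)) * t ^ n * m ^ n := by
          rw [add_sub_cancel, mul_pow]; ring
  have hmn : 0 < m ^ n := pow_pos hm n
  exact le_of_mul_le_mul_right (by linarith) hmn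

section Conjugation

variable {H K : Type*} [NormedAddCommGroup H] [InnerProductSpace ℂ H] [CompleteSpace H]
  [NormedAddCommGroup K] [InnerProductSpace ℂ K] [CompleteSpace K]
  {ι : Type*} [Fintype ι] (V : K →L[ℂ] H) {w : ι → ℝ}

lemma sum_smul_adjoint_conj_mono (hw : ∀ j, 0 ≤ w j) {S T : ι → H →L[ℂ] H}
    (h : ∀ j, S j ≤ T j) :
    ∑ j, w j • ((adjoint V) ∘L (S j) ∘L V) ≤ ∑ j, w j • ((adjoint V) ∘L (T j) ∘L V) := by
  refine Finset.sum_le_sum fun j _ => smul_le_smul_of_nonneg_left ?_ (hw j)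
  rw [le_def]
  simpa [ContinuousLinearMap.sub_comp, ContinuousLinearMap.comp_sub]
    using ((le_def _ _).1 (h j)).adjoint_conj V

lemma sum_smul_adjoint_conj_algebraMap (hV : (adjoint V) ∘L V = 1) (hw1 : ∑ j, w j = 1) (c : ℝ) :
    ∑ j, w j • ((adjoint V) ∘L (algebraMap ℝ (H →L[ℂ] H) c) ∘L V) =
      algebraMap ℝ (K →L[ℂ] K) c := by
  have h : (adjoint V) ∘L (algebraMap ℝ (H →L[ℂ] H) c) ∘L V = algebraMap ℝ (K →L[ℂ] K) c := by
    ext x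
    have hx : (adjoint V) (V x) = x := DFunLike.congr_fun hV x
    simp [Algebra.algebraMap_eq_smul_one, hx]
  rw [h, ← Finset.sum_smul, hw1, one_smul]

lemma isSelfAdjoint_sum_smul_adjoint_conj {T : ι → H →L[ℂ] H} (hT : ∀ j, IsSelfAdjoint (T j)) :
    IsSelfAdjoint (∑ j, w j • ((adjoint V) ∘L (T j) ∘L V)) :=
  isSelfAdjoint_sum _ fun j _ => (IsSelfAdjoint.all (w j)).smul ((hT j).adjoint_conj V)

lemma spectrum_sum_smul_adjoint_conj_cfc_subset (hV : (adjoint V) ∘L V = 1)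
    (hw : ∀ j, 0 ≤ w j) (hw1 : ∑ j, w j = 1) {A : ι → H →L[ℂ] H}
    (hA : ∀ j, IsSelfAdjoint (A j)) {q : ι → ℝ → ℝ}
    (hq : ∀ j, ContinuousOn (q j) (spectrum ℝ (A j))) {l u : ℝ}
    (hqS : ∀ j, ∀ x ∈ spectrum ℝ (A j), q j x ∈ Set.Icc l u) :
    spectrum ℝ (∑ j, w j • ((adjoint V) ∘L (cfc (q j) (A j)) ∘L V)) ⊆ Set.Icc l u := by
  have hB : IsSelfAdjoint (∑ j, w j • ((adjoint V) ∘L (cfc (q j) (A j)) ∘L V)) :=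
    isSelfAdjoint_sum_smul_adjoint_conj V fun j => cfc_predicate _ _
  have hl := sum_smul_adjoint_conj_mono V hw
    fun j => algebraMap_le_cfc (q j) l (A j) (fun x hx => (hqS j x hx).1) (hq j) (hA j)
  have hu := sum_smul_adjoint_conj_mono V hw
    fun j => cfc_le_algebraMap (q j) u (A j) (fun x hx => (hqS j x hx).2) (hq j) (hA j)
  rw [sum_smul_adjoint_conj_algebraMap V hV hw1] at hl hu
  intro x hx
  exact ⟨(algebraMap_le_iff_le_spectrum hB).1 hl x hx, (le_algebraMap_iff_spectrum_le hB).1 hu x hx⟩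

end Conjugation

lemma isCompact_closure_convexHull_of_isBounded {s : Set ℝ} (hs : Bornology.IsBounded s) :
    IsCompact (closure (convexHull ℝ s)) :=
  (isBounded_convexHull.2 hs).isCompact_closure

lemma exists_closure_convexHull_eq_Icc {s : Set ℝ} (hs : Bornology.IsBounded s)
    (hne : s.Nonempty) : ∃ l u, closure (convexHull ℝ s) = Set.Icc l u :=
  ⟨_, _, eq_Icc_of_connected_compact
    ⟨hne.convexHull.closure, (convex_convexHull ℝ s).closure.isPreconnected⟩
    (isCompact_closure_convexHull_of_isBounded hs)⟩

section ExpBound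

variable {K : Type*} [NormedAddCommGroup K] [InnerProductSpace ℂ K] [CompleteSpace K]
  {B : K →L[ℂ] K} {S : Set ℝ}

lemma smul_cfc_exp_add_smul_one (hB : IsSelfAdjoint B) (α c : ℝ) :
    α • cfc Real.exp B + c • (1 : K →L[ℂ] K) = cfc (fun x => α * Real.exp x + c) B := by
  rw [cfc_add_const c (fun x => α * Real.exp x) B, cfc_const_mul α Real.exp B,
    Algebra.algebraMap_eq_smul_one]

lemma le_smul_cfc_exp_add_sSup (hB : IsSelfAdjoint B) (hS : IsCompact S)
    (hBS : spectrum ℝ B ⊆ S) (α : ℝ) :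
    B ≤ α • cfc Real.exp B +
      (sSup ((fun x => x - α * Real.exp x) '' S)) • (1 : K →L[ℂ] K) := by
  rw [smul_cfc_exp_add_smul_one hB]
  conv_lhs => rw [← cfc_id' ℝ B]
  refine cfc_mono fun x hx => ?_
  have := le_csSup (hS.image (f := fun x => x - α * Real.exp x) (by fun_prop)).bddAbove
    (Set.mem_image_of_mem _ (hBS hx))
  linarith

lemma smul_cfc_exp_add_sInf_le (hB : IsSelfAdjoint B) (hS : IsCompact S)
    (hBS : spectrum ℝ B ⊆ S) (α : ℝ) :
    α • cfc Real.exp B +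
      (sInf ((fun x => x - α * Real.exp x) '' S)) • (1 : K →L[ℂ] K) ≤ B := by
  rw [smul_cfc_exp_add_smul_one hB]
  conv_rhs => rw [← cfc_id' ℝ B]
  refine cfc_mono fun x hx => ?_
  have := csInf_le (hS.image (f := fun x => x - α * Real.exp x) (by fun_prop)).bddBelow
    (Set.mem_image_of_mem _ (hBS hx))
  linarith

end ExpBound

lemma sum_smul_cfc_pow {H : Type*} [NormedAddCommGroup H] [InnerProductSpace ℂ H]
    [CompleteSpace H] {A : H →L[ℂ] H} (hA : IsSelfAdjoint A) {f : ℝ → ℝ}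
    (hf : ContinuousOn f (spectrum ℝ A)) (a : ℕ → ℝ) (s : Finset ℕ) :
    ∑ i ∈ s, a i • (cfc f A) ^ i = cfc (fun x => ∑ i ∈ s, a i * f x ^ i) A := by
  have h := cfc_sum (fun i x => a i * f x ^ i) A s (fun i _ => by fun_prop)
  rw [show (fun x => ∑ i ∈ s, a i * f x ^ i) = ∑ i ∈ s, fun x => a i * f x ^ i by
    ext x; simp, h]
  refine Finset.sum_congr rfl fun i _ => ?_
  rw [cfc_const_mul (a i) (fun x => f x ^ i) A, cfc_pow f i A]

lemma sInf_image_Icc_pos {g : ℝ → ℝ} {m M : ℝ} (hmM : m ≤ M)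
    (hg : ContinuousOn g (Set.Icc m M)) (hpos : ∀ x ∈ Set.Icc m M, 0 < g x) :
    0 < sInf (g '' Set.Icc m M) := by
  obtain ⟨x, hx, h⟩ := (isCompact_Icc.image_of_continuousOn hg).sInf_mem
    ((Set.nonempty_Icc.2 hmM).image g)
  exact h ▸ hpos x hx

lemma sum_filter_add_sum_filter_neg (a b : ℕ → ℝ) (s : Finset ℕ) :
    ∑ i ∈ s, a i * b i =
      ∑ i ∈ s.filter (fun i => 0 ≤ a i), a i * b i + ∑ i ∈ s.filter (fun i => a i < 0), a i * b i := by
  simp_rw [← not_le]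
  exact (Finset.sum_filter_add_sum_filter_not s (fun i => 0 ≤ a i) _).symm

section Envelope

variable {a u l : ℕ → ℝ} {x y z : ℝ} {s : Finset ℕ}

lemma inv_mul_pow_le_pow {c : ℝ} (hc : 1 ≤ c) (hx : 0 ≤ x) (hxy : x ≤ y) (i : ℕ) :
    c⁻¹ * x ^ i ≤ y ^ i :=
  (mul_le_of_le_one_left (by positivity) (inv_le_one_of_one_le₀ hc)).trans
    (pow_le_pow_left₀ hx hxy i)

lemma pow_le_mul_pow {c : ℝ} (hc : 1 ≤ c) (hx : 0 ≤ x) (hxy : x ≤ y) (i : ℕ) :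
    x ^ i ≤ c * y ^ i :=
  (pow_le_pow_left₀ hx hxy i).trans
    (le_mul_of_one_le_left (pow_nonneg (hx.trans hxy) i) hc)

lemma sum_mul_pow_le_upper_envelope (hu : ∀ i, 1 ≤ u i) (hl : ∀ i, 1 ≤ l i) (hx : 0 ≤ x)
    (hxy : x ≤ y) (hyz : y ≤ z) :
    ∑ i ∈ s, a i * y ^ i ≤
      ∑ i ∈ s.filter (fun i => 0 ≤ a i), a i * u i * z ^ i +
        ∑ i ∈ s.filter (fun i => a i < 0), a i * (l i)⁻¹ * x ^ i := by
  rw [sum_filter_add_sum_filter_neg a (fun i => y ^ i) s]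
  refine add_le_add (Finset.sum_le_sum fun i hi => ?_) (Finset.sum_le_sum fun i hi => ?_) <;>
    rw [mul_assoc]
  · exact mul_le_mul_of_nonneg_left (pow_le_mul_pow (hu i) (hx.trans hxy) hyz i)
      (Finset.mem_filter.1 hi).2
  · exact mul_le_mul_of_nonpos_left (inv_mul_pow_le_pow (hl i) hx hxy i)
      (Finset.mem_filter.1 hi).2.le

lemma lower_envelope_le_sum_mul_pow (hu : ∀ i, 1 ≤ u i) (hl : ∀ i, 1 ≤ l i) (hx : 0 ≤ x)
    (hxy : x ≤ y) (hyz : y ≤ z) :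
    ∑ i ∈ s.filter (fun i => 0 ≤ a i), a i * (l i)⁻¹ * x ^ i +
      ∑ i ∈ s.filter (fun i => a i < 0), a i * u i * z ^ i ≤ ∑ i ∈ s, a i * y ^ i := by
  rw [sum_filter_add_sum_filter_neg a (fun i => y ^ i) s]
  refine add_le_add (Finset.sum_le_sum fun i hi => ?_) (Finset.sum_le_sum fun i hi => ?_) <;>
    rw [mul_assoc]
  · exact mul_le_mul_of_nonneg_left (inv_mul_pow_le_pow (hl i) hx hxy i)
      (Finset.mem_filter.1 hi).2
  · exact mul_le_mul_of_nonpos_left (pow_le_mul_pow (hu i) (hx.trans hxy) hyz i)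
      (Finset.mem_filter.1 hi).2.le

end Envelope

lemma spectrum_conj_cfc_subset_closure_convexHull {H K : Type*}
    [NormedAddCommGroup H] [InnerProductSpace ℂ H] [CompleteSpace H]
    [NormedAddCommGroup K] [InnerProductSpace ℂ K] [CompleteSpace K]
    {ι : Type*} [Fintype ι] [Nonempty ι] (V : K →L[ℂ] H) (hV : (adjoint V) ∘L V = 1)
    {w : ι → ℝ} (hw : ∀ j, 0 ≤ w j) (hw1 : ∑ j, w j = 1)
    {m M : ι → ℝ} (hmM : ∀ j, m j ≤ M j) {A : ι → H →L[ℂ] H}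
    (hA : ∀ j, IsSelfAdjoint (A j)) (hspec : ∀ j, spectrum ℝ (A j) ⊆ Set.Icc (m j) (M j))
    {q : ι → ℝ → ℝ} (hq : ∀ j, Continuous (q j)) :
    IsCompact (closure (convexHull ℝ (⋃ j, q j '' Set.Icc (m j) (M j)))) ∧
      spectrum ℝ (∑ j, w j • ((adjoint V) ∘L (cfc (q j) (A j)) ∘L V)) ⊆
        closure (convexHull ℝ (⋃ j, q j '' Set.Icc (m j) (M j))) := by
  have hbdd : Bornology.IsBounded (⋃ j, q j '' Set.Icc (m j) (M j)) :=
    (isCompact_iUnion fun j => isCompact_Icc.image (hq j)).isBounded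
  have hne : (⋃ j, q j '' Set.Icc (m j) (M j)).Nonempty :=
    Set.nonempty_iUnion.2 ⟨Classical.arbitrary ι, (Set.nonempty_Icc.2 (hmM _)).image _⟩
  refine ⟨isCompact_closure_convexHull_of_isBounded hbdd, ?_⟩
  obtain ⟨l, u, hlu⟩ := exists_closure_convexHull_eq_Icc hbdd hne
  rw [hlu]
  refine spectrum_sum_smul_adjoint_conj_cfc_subset V hV hw hw1 hA
    (fun j => (hq j).continuousOn) fun j x hx => ?_
  rw [← hlu]
  exact subset_closure (subset_convexHull ℝ _
    (Set.mem_iUnion.2 ⟨j, Set.mem_image_of_mem _ (hspec j hx)⟩))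

theorem stmt6
    {H K : Type*} [NormedAddCommGroup H] [InnerProductSpace ℂ H] [CompleteSpace H]
    [NormedAddCommGroup K] [InnerProductSpace ℂ K] [CompleteSpace K]
    (V : K →L[ℂ] H) (hV : (adjoint V) ∘L V = 1)
    (I : ℕ) (a : ℕ → ℝ)
    (k : ℕ) (hk : 1 ≤ k)
    (w : Fin k → ℝ) (hw : ∀ j, 0 ≤ w j) (hw1 : ∑ j, w j = 1)
    (m M : Fin k → ℝ) (hmM : ∀ j, m j < M j)
    (A : Fin k → H →L[ℂ] H) (hA : ∀ j, IsSelfAdjoint (A j))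
    (hspec : ∀ j, spectrum ℝ (A j) ⊆ Set.Icc (m j) (M j))
    (f : ℝ → ℝ) (hf : ContinuousOn f (⋃ j, Set.Icc (m j) (M j)))
    (pL pU : Polynomial ℝ)
    (hp : ∀ x ∈ ⋃ j, Set.Icc (m j) (M j),
      0 < pL.eval x ∧ pL.eval x ≤ f x ∧ f x ≤ pU.eval x)
    (mU MU mL ML : Fin k → ℝ)
    (hmU : ∀ j, mU j = sInf ((fun x => pU.eval x) '' Set.Icc (m j) (M j)))
    (hMU : ∀ j, MU j = sSup ((fun x => pU.eval x) '' Set.Icc (m j) (M j)))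
    (hmL : ∀ j, mL j = sInf ((fun x => pL.eval x) '' Set.Icc (m j) (M j)))
    (hML : ∀ j, ML j = sSup ((fun x => pL.eval x) '' Set.Icc (m j) (M j)))
    (hUlt : ∀ j, mU j < MU j) (hLlt : ∀ j, mL j < ML j)
    (qU qL : Fin k → ℝ → ℝ)
    (hqU : ∀ j x, qU j x =
      (∑ i ∈ (Finset.range (I + 1)).filter (fun i => 0 ≤ a i),
        a i * kantorovich (mU j) (MU j) (i : ℝ) * (pU.eval x) ^ i) +
      ∑ i ∈ (Finset.range (I + 1)).filter (fun i => a i < 0),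
        a i * (kantorovich (mL j) (ML j) (i : ℝ))⁻¹ * (pL.eval x) ^ i)
    (hqL : ∀ j x, qL j x =
      (∑ i ∈ (Finset.range (I + 1)).filter (fun i => 0 ≤ a i),
        a i * (kantorovich (mL j) (ML j) (i : ℝ))⁻¹ * (pL.eval x) ^ i) +
      ∑ i ∈ (Finset.range (I + 1)).filter (fun i => a i < 0),
        a i * kantorovich (mU j) (MU j) (i : ℝ) * (pU.eval x) ^ i)
    (BU BL : K →L[ℂ] K)
    (hBU : BU = ∑ j, w j • ((adjoint V) ∘L (cfc (qU j) (A j)) ∘L V))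
    (hBL : BL = ∑ j, w j • ((adjoint V) ∘L (cfc (qL j) (A j)) ∘L V))
    (SU SL : Set ℝ)
    (hSU : SU = closure (convexHull ℝ (⋃ j, qU j '' Set.Icc (m j) (M j))))
    (hSL : SL = closure (convexHull ℝ (⋃ j, qL j '' Set.Icc (m j) (M j))))
    (α : ℝ) :
    ((∑ j, w j • ((adjoint V) ∘L (∑ i ∈ Finset.range (I + 1), a i • (cfc f (A j)) ^ i) ∘L V)) ≤
      α • cfc Real.exp BU + (sSup ((fun x => x - α * Real.exp x) '' SU)) • (1 : K →L[ℂ] K)) ∧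
    α • cfc Real.exp BL + (sInf ((fun x => x - α * Real.exp x) '' SL)) • (1 : K →L[ℂ] K) ≤
      (∑ j, w j • ((adjoint V) ∘L (∑ i ∈ Finset.range (I + 1), a i • (cfc f (A j)) ^ i) ∘L V)) := by
  have : Nonempty (Fin k) := ⟨⟨0, hk⟩⟩
  have hp' : ∀ j, ∀ x ∈ Set.Icc (m j) (M j),
      0 < pL.eval x ∧ pL.eval x ≤ f x ∧ f x ≤ pU.eval x :=
    fun j x hx => hp x (Set.mem_iUnion.2 ⟨j, hx⟩)
  have hKU : ∀ j (i : ℕ), 1 ≤ kantorovich (mU j) (MU j) i := fun j i =>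
    one_le_kantorovich (hmU j ▸ sInf_image_Icc_pos (hmM j).le pU.continuous.continuousOn
      fun x hx => by linarith [hp' j x hx]) (hUlt j) i
  have hKL : ∀ j (i : ℕ), 1 ≤ kantorovich (mL j) (ML j) i := fun j i =>
    one_le_kantorovich (hmL j ▸ sInf_image_Icc_pos (hmM j).le pL.continuous.continuousOn
      fun x hx => (hp' j x hx).1) (hLlt j) i
  have hfA : ∀ j, ContinuousOn f (spectrum ℝ (A j)) := fun j =>
    hf.mono ((hspec j).trans (Set.subset_iUnion (fun j => Set.Icc (m j) (M j)) j))
  have hqUc : ∀ j, Continuous (qU j) := fun j => by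
    rw [funext (hqU j)]; fun_prop
  have hqLc : ∀ j, Continuous (qL j) := fun j => by
    rw [funext (hqL j)]; fun_prop
  obtain ⟨hSUc, hBUS⟩ := spectrum_conj_cfc_subset_closure_convexHull V hV hw hw1
    (fun j => (hmM j).le) hA hspec hqUc
  obtain ⟨hSLc, hBLS⟩ := spectrum_conj_cfc_subset_closure_convexHull V hV hw hw1
    (fun j => (hmM j).le) hA hspec hqLc
  rw [← hSU] at hSUc hBUS
  rw [← hSL] at hSLc hBLS
  rw [← hBU] at hBUS
  rw [← hBL] at hBLS
  have hBUsa : IsSelfAdjoint BU :=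
    hBU ▸ isSelfAdjoint_sum_smul_adjoint_conj V fun j => cfc_predicate _ _
  have hBLsa : IsSelfAdjoint BL :=
    hBL ▸ isSelfAdjoint_sum_smul_adjoint_conj V fun j => cfc_predicate _ _
  simp_rw [fun j => sum_smul_cfc_pow (hA j) (hfA j) a (Finset.range (I + 1))]
  constructor
  · refine le_trans ?_ (le_smul_cfc_exp_add_sSup hBUsa hSUc hBUS α)
    rw [hBU]
    refine sum_smul_adjoint_conj_mono V hw fun j => cfc_mono (fun x hx => ?_)
      (by have := hfA j; fun_prop) (hqUc j).continuousOn
    obtain ⟨h0, h1, h2⟩ := hp' j x (hspec j hx)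
    rw [hqU]
    exact sum_mul_pow_le_upper_envelope (hKU j) (hKL j) h0.le h1 h2
  · refine le_trans (smul_cfc_exp_add_sInf_le hBLsa hSLc hBLS α) ?_
    rw [hBL]
    refine sum_smul_adjoint_conj_mono V hw fun j => cfc_mono (fun x hx => ?_)
      (hqLc j).continuousOn (by have := hfA j; fun_prop)
    obtain ⟨h0, h1, h2⟩ := hp' j x (hspec j hx)
    rw [hqL]
    exact lower_envelope_le_sum_mul_pow (hKU j) (hKL j) h0.le h1 h2
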